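/- If there is an ALC concept of size at most k' = n + k + 2 that fits P = {(I,a)}, N = {(J,b)}, then there is an L({∃}) concept of size at most k' of the form ∃r.D that fits P, N. -/

import Mathlib

open scoped ENNReal

namespace ALCPaper

/-- ALC concepts; concept names and role names are natural numbers. -/
inductive ALC : Type
  | bot
  | top
  | atom (A : ℕ)
  | neg (c : ALC)
  | inter (c d : ALC)
  | union (c d : ALC)
  | all (r : ℕ) (c : ALC)
  | ex (r : ℕ) (c : ALC)
  deriving DecidableEq

/-- An interpretation: a domain of natural numbers, extensions of concept names,
and extensions of role names. -/
structure Interp where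
  dom : Set ℕ
  cI : ℕ → Set ℕ
  rI : ℕ → Set (ℕ × ℕ)

/-- Well-formedness of an interpretation: the domain is nonempty, concept name
extensions are subsets of the domain and role name extensions are binary relations
on the domain. -/
def Interp.WF (I : Interp) : Prop :=
  I.dom.Nonempty ∧ (∀ A, I.cI A ⊆ I.dom) ∧
    ∀ r, ∀ p ∈ I.rI r, p.1 ∈ I.dom ∧ p.2 ∈ I.dom

/-- The extension `C^I` of a concept `C` in an interpretation `I`. -/
def ALC.sem : ALC → Interp → Set ℕ
  | .bot, _ => ∅
  | .top, I => I.dom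
  | .atom A, I => I.cI A
  | .neg c, I => I.dom \ c.sem I
  | .inter c d, I => c.sem I ∩ d.sem I
  | .union c d, I => c.sem I ∪ d.sem I
  | .all r c, I => {d | d ∈ I.dom ∧ ∀ e, (d, e) ∈ I.rI r → e ∈ c.sem I}
  | .ex r c, I => {d | ∃ e, (d, e) ∈ I.rI r ∧ e ∈ c.sem I}

/-- The size of a concept: the number of nodes of its syntax tree. -/
def ALC.size : ALC → ℕ
  | .bot => 1
  | .top => 1
  | .atom _ => 1
  | .neg c => c.size + 1
  | .inter c d => c.size + d.size + 1
  | .union c d => c.size + d.size + 1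
  | .all _ c => c.size + 1
  | .ex _ c => c.size + 1

/-- The quantifier depth of a concept: the nesting depth of ∃/∀. -/
def ALC.qdepth : ALC → ℕ
  | .bot => 0
  | .top => 0
  | .atom _ => 0
  | .neg c => c.qdepth
  | .inter c d => max c.qdepth d.qdepth
  | .union c d => max c.qdepth d.qdepth
  | .all _ c => c.qdepth + 1
  | .ex _ c => c.qdepth + 1

/-- The concept names occurring in a concept. -/
def ALC.conceptNames : ALC → Finset ℕ
  | .bot => ∅
  | .top => ∅
  | .atom A => {A}
  | .neg c => c.conceptNames
  | .inter c d => c.conceptNames ∪ d.conceptNames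
  | .union c d => c.conceptNames ∪ d.conceptNames
  | .all _ c => c.conceptNames
  | .ex _ c => c.conceptNames

/-- The role names occurring in a concept. -/
def ALC.roleNames : ALC → Finset ℕ
  | .bot => ∅
  | .top => ∅
  | .atom _ => ∅
  | .neg c => c.roleNames
  | .inter c d => c.roleNames ∪ d.roleNames
  | .union c d => c.roleNames ∪ d.roleNames
  | .all r c => insert r c.roleNames
  | .ex r c => insert r c.roleNames

/-- The five constructors ¬, ⊓, ⊔, ∀, ∃. -/
inductive Op : Type
  | neg | inter | union | all | ex
  deriving DecidableEq

/-- Membership in the fragment L(O): the concept is built from ⊤, ⊥ and concept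
names using only constructors from O. -/
def ALC.InLang (O : Set Op) : ALC → Prop
  | .bot => True
  | .top => True
  | .atom _ => True
  | .neg c => Op.neg ∈ O ∧ c.InLang O
  | .inter c d => Op.inter ∈ O ∧ c.InLang O ∧ d.InLang O
  | .union c d => Op.union ∈ O ∧ c.InLang O ∧ d.InLang O
  | .all _ c => Op.all ∈ O ∧ c.InLang O
  | .ex _ c => Op.ex ∈ O ∧ c.InLang O

/-- The dual of a constructor. -/
def Op.dual : Op → Op
  | .neg => .neg
  | .inter => .union
  | .union => .inter
  | .all => .ex
  | .ex => .all

/-- The dual concept C̄. -/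
def ALC.dual : ALC → ALC
  | .bot => .top
  | .top => .bot
  | .atom A => .atom A
  | .neg c => .neg c.dual
  | .inter c d => .union c.dual d.dual
  | .union c d => .inter c.dual d.dual
  | .all r c => .ex r c.dual
  | .ex r c => .all r c.dual

open Classical in
/-- The interpretation Ī_Σ obtained by complementing the extensions of the concept
names in Σ (here `S` is the set of concept names of the signature Σ). -/
noncomputable def Interp.dualWrt (I : Interp) (S : Set ℕ) : Interp where
  dom := I.dom
  cI := fun A => if A ∈ S then I.dom \ I.cI A else I.cI A
  rI := I.rI

/-- A pointed interpretation. -/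
abbrev Ex : Type := Interp × ℕ

/-- A finite interpretation: finite domain and only finitely many concept and role
names with nonempty extension. -/
def Interp.FiniteI (I : Interp) : Prop :=
  I.dom.Finite ∧ {A | (I.cI A).Nonempty}.Finite ∧ {r | (I.rI r).Nonempty}.Finite

/-- An example: a finite (well-formed) interpretation with a distinguished domain
element. -/
def IsExample (e : Ex) : Prop := e.1.WF ∧ e.1.FiniteI ∧ e.2 ∈ e.1.dom

/-- The dual example (Ī_Σ, a). -/
noncomputable def dualEx (S : Set ℕ) (e : Ex) : Ex := (e.1.dualWrt S, e.2)

/-- `C` fits the positive examples `P` and the negative examples `N`. -/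
def Fits (C : ALC) (P N : Set Ex) : Prop :=
  (∀ e ∈ P, e.2 ∈ C.sem e.1) ∧ ∀ e ∈ N, e.2 ∉ C.sem e.1

/-- Subsumption C ⊑ D: `C^I ⊆ D^I` for every interpretation `I`. -/
def Subsume (C D : ALC) : Prop := ∀ I : Interp, I.WF → C.sem I ⊆ D.sem I

/-- Equivalence of concepts. -/
def CEquiv (C D : ALC) : Prop := Subsume C D ∧ Subsume D C

/-- The concept names occurring in (the facts of) a set of examples. -/
def exCNames (E : Set Ex) : Set ℕ := {A | ∃ e ∈ E, (e.1.cI A).Nonempty}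

/-- The role names occurring in (the facts of) a set of examples. -/
def exRNames (E : Set Ex) : Set ℕ := {r | ∃ e ∈ E, (e.1.rI r).Nonempty}

/-! Encoding of the domain elements used in the hitting-set reduction.
Tags < 7 together with `Nat.pair` give an injective encoding into ℕ. -/

def el (tag j i : ℕ) : ℕ := tag + 7 * Nat.pair j i

/-- the root `b` of `J` -/
def eB : ℕ := el 0 0 0
/-- the element `b_{j,i}` -/
def eBB (j i : ℕ) : ℕ := el 1 j i
/-- the element `b'_{j,i}` -/
def eBB' (j i : ℕ) : ℕ := el 2 j i
/-- the sink `c` -/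
def eC : ℕ := el 3 0 0
/-- the root `a` of `I` -/
def eA : ℕ := el 4 0 0
/-- the element `a_i` -/
def eAA (i : ℕ) : ℕ := el 5 0 i
/-- the element `a'_i` -/
def eAA' (i : ℕ) : ℕ := el 6 0 i

/-- The r-edges of `J` not involving the root `b`. -/
def JrCore (m n : ℕ) (S : ℕ → Set ℕ) : Set (ℕ × ℕ) :=
  {p | ∃ j i, 1 ≤ j ∧ j ≤ m ∧ 1 ≤ i ∧ i ≤ n ∧ p = (eBB j (i - 1), eBB j i)} ∪
  {p | ∃ j i, 1 ≤ j ∧ j ≤ m ∧ 1 ≤ i ∧ i ≤ n ∧ i ∉ S j ∧ p = (eBB' j i, eC)} ∪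
  {p | ∃ j, 1 ≤ j ∧ j ≤ m ∧ p = (eBB j n, eC)} ∪ {(eC, eC)}

/-- The r-edges of `J`. -/
def JrPairs (m n : ℕ) (S : ℕ → Set ℕ) : Set (ℕ × ℕ) :=
  {p | ∃ j, 1 ≤ j ∧ j ≤ m ∧ p = (eB, eBB j 0)} ∪ JrCore m n S

/-- The s-edges of `J` (none of them involves the root `b`). -/
def JsPairs (m n : ℕ) (S : ℕ → Set ℕ) : Set (ℕ × ℕ) :=
  {p | ∃ j i, 1 ≤ j ∧ j ≤ m ∧ 1 ≤ i ∧ i ≤ n ∧ i ∉ S j ∧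
      (p = (eBB j (i - 1), eBB' j i) ∨ p = (eBB' j i, eBB j i))} ∪
  {p | ∃ j i, 1 ≤ j ∧ j ≤ m ∧ 1 ≤ i ∧ i ≤ n ∧ i ∈ S j ∧ p = (eBB j (i - 1), eC)} ∪
  {p | ∃ j, 1 ≤ j ∧ j ≤ m ∧ p = (eBB j n, eC)} ∪ {(eC, eC)}

/-- The domain of `J`. -/
def Jdom (m n : ℕ) (S : ℕ → Set ℕ) : Set ℕ :=
  {eB} ∪ {x | ∃ j i, 1 ≤ j ∧ j ≤ m ∧ i ≤ n ∧ x = eBB j i} ∪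
  {x | ∃ j i, 1 ≤ j ∧ j ≤ m ∧ 1 ≤ i ∧ i ≤ n ∧ i ∉ S j ∧ x = eBB' j i} ∪ {eC}

/-- The interpretation `J` of the reduction; concept name `A` is 0, role names
`r`, `s` are 0 and 1. -/
def Jinterp (m n : ℕ) (S : ℕ → Set ℕ) : Interp where
  dom := Jdom m n S
  cI := fun A => if A = 0 then {x | ∃ j, 1 ≤ j ∧ j ≤ m ∧ x = eBB j n} else ∅
  rI := fun ρ => if ρ = 0 then JrPairs m n S else if ρ = 1 then JsPairs m n S else ∅

/-- The domain of `I`: `J` without `b`, extended by `a`, `a_0, …, a_n` and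
`a'_1, …, a'_n`. -/
def Idom (m n : ℕ) (S : ℕ → Set ℕ) : Set ℕ :=
  (Jdom m n S \ {eB}) ∪ {eA} ∪ {x | ∃ i, i ≤ n ∧ x = eAA i} ∪
  {x | ∃ i, 1 ≤ i ∧ i ≤ n ∧ x = eAA' i}

/-- The r-edges of `I`. -/
def IrPairs (m n : ℕ) (S : ℕ → Set ℕ) : Set (ℕ × ℕ) :=
  JrCore m n S ∪ {(eA, eAA 0)} ∪ {p | ∃ j, 1 ≤ j ∧ j ≤ m ∧ p = (eA, eBB j 0)} ∪
  {p | ∃ i, 1 ≤ i ∧ i ≤ n ∧ p = (eAA (i - 1), eAA i)} ∪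
  {p | ∃ i, 1 ≤ i ∧ i ≤ n ∧ p = (eAA' i, eC)} ∪ {(eAA n, eC)}

/-- The s-edges of `I`. -/
def IsPairs (m n : ℕ) (S : ℕ → Set ℕ) : Set (ℕ × ℕ) :=
  JsPairs m n S ∪
  {p | ∃ i, 1 ≤ i ∧ i ≤ n ∧ (p = (eAA (i - 1), eAA' i) ∨ p = (eAA' i, eAA i))} ∪
  {(eAA n, eC)}

/-- The interpretation `I` of the reduction. -/
def Iinterp (m n : ℕ) (S : ℕ → Set ℕ) : Interp where
  dom := Idom m n S
  cI := fun A =>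
    if A = 0 then {x | ∃ j, 1 ≤ j ∧ j ≤ m ∧ x = eBB j n} ∪ {eAA n} else ∅
  rI := fun ρ => if ρ = 0 then IrPairs m n S else if ρ = 1 then IsPairs m n S else ∅

/-- The concepts `C_i` built from a hitting set `H`: `C_0 = A` and
`C_i = ∃s.∃s.C_{i-1}` if `n − i + 1 ∈ H`, `C_i = ∃r.C_{i-1}` otherwise. -/
def hsConcept (H : Finset ℕ) (n : ℕ) : ℕ → ALC
  | 0 => .atom 0
  | i + 1 => if n - i ∈ H then .ex 1 (.ex 1 (hsConcept H n i)) else .ex 0 (hsConcept H n i)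

/-- `chainA [t₁, …, t_ℓ]` is the concept `∃t₁.….∃t_ℓ.A`. -/
def chainA : List ℕ → ALC
  | [] => .atom 0
  | t :: ts => .ex t (chainA ts)

set_option linter.unusedSimpArgs false

theorem el_inj {t j i t' j' i' : ℕ} (h : t < 7) (h' : t' < 7) :
    el t j i = el t' j' i' ↔ t = t' ∧ j = j' ∧ i = i' := by
  unfold el
  constructor
  · intro e
    have h1 : t = t' := by omega
    have h2 : Nat.pair j i = Nat.pair j' i' := by omega
    exact ⟨h1, Nat.pair_eq_pair.mp h2⟩
  · rintro ⟨rfl, rfl, rfl⟩; rfl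

def Det (I : Interp) (x ρ y : ℕ) : Prop := ∀ e, (x, e) ∈ I.rI ρ ↔ e = y

theorem det_ex {I : Interp} {x ρ y : ℕ} (h : Det I x ρ y) (D : ALC) :
    x ∈ (ALC.ex ρ D).sem I ↔ y ∈ D.sem I := by
  simp only [ALC.sem, Set.mem_setOf_eq, h _, exists_eq_left]

theorem det_all {I : Interp} {x ρ y : ℕ} (hx : x ∈ I.dom) (h : Det I x ρ y) (D : ALC) :
    x ∈ (ALC.all ρ D).sem I ↔ y ∈ D.sem I := by
  simp only [ALC.sem, Set.mem_setOf_eq, h _, forall_eq, hx, true_and]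

section
variable {m n : ℕ} {S : ℕ → Set ℕ}

theorem I_c (ρ : ℕ) (hρ : ρ < 2) : Det (Iinterp m n S) eC ρ eC := by
  intro e
  interval_cases ρ <;>
  simp [Iinterp, IrPairs, IsPairs, JrCore, JsPairs, eA, eAA, eAA', eB, eBB, eBB', eC, el_inj]

theorem I_an (ρ : ℕ) (hρ : ρ < 2) : Det (Iinterp m n S) (eAA n) ρ eC := by
  intro e
  interval_cases ρ <;>
  simp [Iinterp, IrPairs, IsPairs, JrCore, JsPairs, eA, eAA, eAA', eB, eBB, eBB', eC, el_inj] <;>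
  intros <;> omega

theorem I_a0 {i : ℕ} (hi : i < n) : Det (Iinterp m n S) (eAA i) 0 (eAA (i+1)) := by
  intro e
  simp [Iinterp, IrPairs, IsPairs, JrCore, JsPairs, eA, eAA, eAA', eB, eBB, eBB', eC, el_inj]
  constructor
  · grind
  · have e1 : i = i + 1 - 1 := by omega
    have e2 : i + 1 ≤ n := hi
    have e3 : 1 ≤ i + 1 := by omega
    grind

theorem I_a1 {i : ℕ} (hi : i < n) : Det (Iinterp m n S) (eAA i) 1 (eAA' (i+1)) := by
  intro e
  simp [Iinterp, IrPairs, IsPairs, JrCore, JsPairs, eA, eAA, eAA', eB, eBB, eBB', eC, el_inj]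
  constructor
  · grind
  · have e1 : i = i + 1 - 1 := by omega
    have e2 : i + 1 ≤ n := hi
    have e3 : 1 ≤ i + 1 := by omega
    grind

theorem I_a'0 {i : ℕ} (h1 : 1 ≤ i) (hi : i ≤ n) : Det (Iinterp m n S) (eAA' i) 0 eC := by
  intro e
  simp [Iinterp, IrPairs, IsPairs, JrCore, JsPairs, eA, eAA, eAA', eB, eBB, eBB', eC, el_inj]
  intros; omega

theorem I_a'1 {i : ℕ} (h1 : 1 ≤ i) (hi : i ≤ n) : Det (Iinterp m n S) (eAA' i) 1 (eAA i) := by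
  intro e
  simp [Iinterp, IrPairs, IsPairs, JrCore, JsPairs, eA, eAA, eAA', eB, eBB, eBB', eC, el_inj]
  grind

theorem I_bn {j : ℕ} (h1 : 1 ≤ j) (hj : j ≤ m) (ρ : ℕ) (hρ : ρ < 2) :
    Det (Iinterp m n S) (eBB j n) ρ eC := by
  intro e
  interval_cases ρ <;>
  simp [Iinterp, IrPairs, IsPairs, JrCore, JsPairs, eA, eAA, eAA', eB, eBB, eBB', eC, el_inj] <;>
  grind

theorem I_b0 {j i : ℕ} (h1 : 1 ≤ j) (hj : j ≤ m) (hi : i < n) :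
    Det (Iinterp m n S) (eBB j i) 0 (eBB j (i+1)) := by
  intro e
  simp [Iinterp, IrPairs, IsPairs, JrCore, JsPairs, eA, eAA, eAA', eB, eBB, eBB', eC, el_inj]
  constructor
  · grind
  · have e1 : i = i + 1 - 1 := by omega
    have e2 : i + 1 ≤ n := hi
    have e3 : 1 ≤ i + 1 := by omega
    grind

theorem I_b1 {j i : ℕ} (h1 : 1 ≤ j) (hj : j ≤ m) (hi : i < n) (hs : i + 1 ∉ S j) :
    Det (Iinterp m n S) (eBB j i) 1 (eBB' j (i+1)) := by
  intro e
  simp [Iinterp, IrPairs, IsPairs, JrCore, JsPairs, eA, eAA, eAA', eB, eBB, eBB', eC, el_inj]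
  constructor
  · grind
  · have e1 : i = i + 1 - 1 := by omega
    have e2 : i + 1 ≤ n := hi
    have e3 : 1 ≤ i + 1 := by omega
    grind

theorem I_b1c {j i : ℕ} (h1 : 1 ≤ j) (hj : j ≤ m) (hi : i < n) (hs : i + 1 ∈ S j) :
    Det (Iinterp m n S) (eBB j i) 1 eC := by
  intro e
  simp [Iinterp, IrPairs, IsPairs, JrCore, JsPairs, eA, eAA, eAA', eB, eBB, eBB', eC, el_inj]
  constructor
  · grind
  · have e1 : i = i + 1 - 1 := by omega
    have e2 : i + 1 ≤ n := hi
    have e3 : 1 ≤ i + 1 := by omega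
    grind

theorem I_b'0 {j i : ℕ} (h1 : 1 ≤ j) (hj : j ≤ m) (h1' : 1 ≤ i) (hi : i ≤ n) (hs : i ∉ S j) :
    Det (Iinterp m n S) (eBB' j i) 0 eC := by
  intro e
  simp [Iinterp, IrPairs, IsPairs, JrCore, JsPairs, eA, eAA, eAA', eB, eBB, eBB', eC, el_inj]
  grind

theorem I_b'1 {j i : ℕ} (h1 : 1 ≤ j) (hj : j ≤ m) (h1' : 1 ≤ i) (hi : i ≤ n) (hs : i ∉ S j) :
    Det (Iinterp m n S) (eBB' j i) 1 (eBB j i) := by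
  intro e
  simp [Iinterp, IrPairs, IsPairs, JrCore, JsPairs, eA, eAA, eAA', eB, eBB, eBB', eC, el_inj]
  grind

theorem I_no {x e ρ : ℕ} (h : 2 ≤ ρ) : (x, e) ∉ (Iinterp m n S).rI ρ := by
  simp [Iinterp, show ρ ≠ 0 by omega, show ρ ≠ 1 by omega]

/-- positive node -/
def an (p : Bool) (i : ℕ) : ℕ := if p then eAA' i else eAA i
/-- negative node; index `0` stands for the sink -/
def bn (p : Bool) (j i : ℕ) : ℕ := if j = 0 then eC else if p then eBB' j i else eBB j i

def Sep (m n : ℕ) (S : ℕ → Set ℕ) (D : ALC) (x y : ℕ) : Prop :=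
  ¬ (x ∈ D.sem (Iinterp m n S) ↔ y ∈ D.sem (Iinterp m n S))

def Valid (m n : ℕ) (S : ℕ → Set ℕ) (p : Bool) (i : ℕ) (X : Set ℕ) : Prop :=
  i ≤ n ∧ (p = true → 1 ≤ i) ∧ ∀ j ∈ X, j ≤ m ∧ (p = true → j ≠ 0 → i ∉ S j)

def Concl (n : ℕ) (S : ℕ → Set ℕ) (p : Bool) (i : ℕ) (X : Set ℕ) (s : ℕ) : Prop :=
  ∃ H : Finset ℕ, H ⊆ Finset.Ioc i n ∧ (∀ j ∈ X, j ≠ 0 → ∃ h ∈ H, h ∈ S j) ∧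
    n - i + H.card + 1 + (if p then 1 else 0) ≤ s

def Q (m n : ℕ) (S : ℕ → Set ℕ) (D : ALC) : Prop :=
  ∀ p i X, Valid m n S p i X → X.Nonempty → (∀ j ∈ X, Sep m n S D (an p i) (bn p j i)) →
    Concl n S p i X D.size

theorem an_dom {p i X} (h : Valid m n S p i X) : an p i ∈ (Iinterp m n S).dom := by
  obtain ⟨h1, h2, -⟩ := h
  cases p
  · simp only [an, Iinterp, Idom]
    exact Or.inl (Or.inr ⟨i, h1, rfl⟩)
  · exact Or.inr ⟨i, h2 rfl, h1, rfl⟩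

theorem bn_dom {p i X j} (h : Valid m n S p i X) (hj : j ∈ X) :
    bn p j i ∈ (Iinterp m n S).dom := by
  obtain ⟨h1, h2, h3⟩ := h
  obtain ⟨h4, h5⟩ := h3 j hj
  refine Or.inl (Or.inl (Or.inl ⟨?_, ?_⟩))
  · unfold bn
    split_ifs with hj0 hp
    · exact Or.inr rfl
    · exact Or.inl (Or.inr ⟨j, i, by omega, h4, h2 hp, h1, h5 hp hj0, rfl⟩)
    · exact Or.inl (Or.inl (Or.inr ⟨j, i, by omega, h4, h1, rfl⟩))
  · unfold bn
    split_ifs <;> simp [eB, eBB, eBB', eC, el_inj]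

theorem Concl.mono {p i X s t} (h : Concl n S p i X s) (hst : s ≤ t) : Concl n S p i X t := by
  obtain ⟨H, h1, h2, h3⟩ := h
  exact ⟨H, h1, h2, h3.trans hst⟩

theorem Q_bin {D1 D2 D : ALC} (h1 : Q m n S D1) (h2 : Q m n S D2)
    (hs : D1.size + D2.size + 1 ≤ D.size)
    (hsep : ∀ x y, Sep m n S D x y → Sep m n S D1 x y ∨ Sep m n S D2 x y) : Q m n S D := by
  intro p i X hv hX hS
  have hv' : ∀ Y ⊆ X, Valid m n S p i Y := fun Y hY =>
    ⟨hv.1, hv.2.1, fun j hj => hv.2.2 j (hY hj)⟩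
  by_cases e1 : ∃ j ∈ X, Sep m n S D1 (an p i) (bn p j i)
  · by_cases e2 : ∃ j ∈ X, Sep m n S D2 (an p i) (bn p j i)
    · obtain ⟨H1, a1, b1, c1⟩ := h1 p i {j ∈ X | Sep m n S D1 (an p i) (bn p j i)}
        (hv' _ (fun j hj => hj.1)) e1 (fun j hj => hj.2)
      obtain ⟨H2, a2, b2, c2⟩ := h2 p i {j ∈ X | Sep m n S D2 (an p i) (bn p j i)}
        (hv' _ (fun j hj => hj.1)) e2 (fun j hj => hj.2)
      refine ⟨H1 ∪ H2, Finset.union_subset a1 a2, ?_, ?_⟩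
      · intro j hj hj0
        rcases hsep _ _ (hS j hj) with h | h
        · obtain ⟨x, hx, hx'⟩ := b1 j ⟨hj, h⟩ hj0
          exact ⟨x, Finset.mem_union_left _ hx, hx'⟩
        · obtain ⟨x, hx, hx'⟩ := b2 j ⟨hj, h⟩ hj0
          exact ⟨x, Finset.mem_union_right _ hx, hx'⟩
      · have := Finset.card_union_le H1 H2
        split_ifs at * <;> omega
    · refine (h1 p i X hv hX fun j hj => ?_).mono (by omega)
      exact (hsep _ _ (hS j hj)).resolve_right fun h => e2 ⟨j, hj, h⟩
  · refine (h2 p i X hv hX fun j hj => ?_).mono (by omega)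
    exact (hsep _ _ (hS j hj)).resolve_left fun h => e1 ⟨j, hj, h⟩

theorem Q_quant {D E : ALC} (ρ : ℕ) (hQ : Q m n S D) (hs : D.size + 1 ≤ E.size)
    (hdet : ∀ x x', x ∈ (Iinterp m n S).dom → Det (Iinterp m n S) x ρ x' →
      (x ∈ E.sem (Iinterp m n S) ↔ x' ∈ D.sem (Iinterp m n S)))
    (hno : 2 ≤ ρ → ∀ x y, x ∈ (Iinterp m n S).dom → y ∈ (Iinterp m n S).dom →
      ¬ Sep m n S E x y) : Q m n S E := by
  intro p i X hv hX hS
  have hsep : ∀ j ∈ X, ∀ x' y', Det (Iinterp m n S) (an p i) ρ x' →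
      Det (Iinterp m n S) (bn p j i) ρ y' → Sep m n S D x' y' := by
    intro j hj x' y' hx hy
    have := hS j hj
    unfold Sep at this ⊢
    rwa [hdet _ _ (an_dom hv) hx, hdet _ _ (bn_dom hv hj) hy] at this
  obtain ⟨j0, hj0⟩ := hX
  by_cases hρ : 2 ≤ ρ
  · exact absurd (hS j0 hj0) (hno hρ _ _ (an_dom hv) (bn_dom hv hj0))
  obtain ⟨hi, hp, hm⟩ := hv
  cases p with
  | true =>
    have hp := hp rfl
    have hm : ∀ j ∈ X, j ≤ m ∧ (j ≠ 0 → i ∉ S j) := fun j hj => ⟨(hm j hj).1, (hm j hj).2 rfl⟩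
    by_cases hρ0 : ρ = 0
    · subst hρ0
      refine absurd Iff.rfl (hsep j0 hj0 eC eC (I_a'0 hp hi) ?_)
      unfold bn
      by_cases h0 : j0 = 0
      · rw [if_pos h0]; exact I_c 0 (by omega)
      · rw [if_neg h0, if_pos rfl]
        exact I_b'0 (by omega) (hm _ hj0).1 hp hi ((hm _ hj0).2 h0)
    · obtain rfl : ρ = 1 := by omega
      obtain ⟨H, a, b, c⟩ := hQ false i X ⟨hi, by simp, fun j hj => ⟨(hm j hj).1, by simp⟩⟩
        ⟨j0, hj0⟩ (by
          intro j hj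
          refine hsep j hj _ _ (I_a'1 hp hi) ?_
          unfold bn
          by_cases h0 : j = 0
          · simp only [h0, if_true]; exact I_c 1 (by omega)
          · simp only [h0, if_false, if_true]
            exact I_b'1 (by omega) (hm _ hj).1 hp hi ((hm _ hj).2 h0))
      refine ⟨H, a, b, ?_⟩
      simp at c ⊢; omega
  | false =>
    rcases Nat.lt_or_ge i n with hin | hin
    · by_cases hρ0 : ρ = 0
      · subst hρ0
        obtain ⟨H, a, b, c⟩ := hQ false (i+1) X ⟨hin, by simp, fun j hj => ⟨(hm j hj).1, by simp⟩⟩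
          ⟨j0, hj0⟩ (by
            intro j hj
            refine hsep j hj _ _ (I_a0 hin) ?_
            unfold bn
            by_cases h0 : j = 0
            · simp only [h0, if_true]; exact I_c 0 (by omega)
            · simp only [h0, if_false]
              exact I_b0 (by omega) (hm _ hj).1 hin)
        refine ⟨H, a.trans (Finset.Ioc_subset_Ioc_left (by omega)), b, ?_⟩
        simp at c ⊢; omega
      · obtain rfl : ρ = 1 := by omega
        classical
        set f : ℕ → ℕ := fun j => if i + 1 ∈ S j then 0 else j with hf
        obtain ⟨H, a, b, c⟩ := hQ true (i+1) (f '' X) ⟨hin, by simp, by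
            rintro _ ⟨j, hj, rfl⟩
            simp only [hf]
            split_ifs with h
            · simp
            · exact ⟨(hm j hj).1, fun _ _ => h⟩⟩
          ⟨_, j0, hj0, rfl⟩ (by
            rintro _ ⟨j, hj, rfl⟩
            refine hsep j hj _ _ (I_a1 hin) ?_
            unfold bn
            by_cases h0 : j = 0
            · have : f j = 0 := by simp [hf, h0]
              rw [if_pos h0, if_pos this]; exact I_c 1 (by omega)
            · by_cases hs : i + 1 ∈ S j
              · have : f j = 0 := by simp [hf, hs]
                rw [if_neg h0, if_pos this]
                exact I_b1c (by omega) (hm _ hj).1 hin hs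
              · have : f j = j := by simp [hf, hs]
                rw [this, if_neg h0, if_neg h0]
                exact I_b1 (by omega) (hm _ hj).1 hin hs)
        refine ⟨insert (i+1) H, ?_, ?_, ?_⟩
        · refine Finset.insert_subset (by simp; omega)
            (a.trans (Finset.Ioc_subset_Ioc_left (by omega)))
        · intro j hj hj0
          by_cases hs : i + 1 ∈ S j
          · exact ⟨i+1, Finset.mem_insert_self _ _, hs⟩
          · have : f j = j := by simp [hf, hs]
            obtain ⟨h, hh, hh'⟩ := b j ⟨j, hj, this⟩ hj0
            exact ⟨h, Finset.mem_insert_of_mem hh, hh'⟩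
        · have := Finset.card_insert_le (i+1) H
          simp at c ⊢; omega
    · obtain rfl : i = n := by omega
      refine absurd Iff.rfl (hsep j0 hj0 eC eC (I_an ρ (by omega)) ?_)
      unfold bn
      by_cases h0 : j0 = 0
      · rw [if_pos h0]; exact I_c ρ (by omega)
      · rw [if_neg h0]
        exact I_bn (by omega) (hm _ hj0).1 ρ (by omega)

theorem Q_all (D : ALC) : Q m n S D := by
  induction D with
  | bot =>
    intro p i X hv ⟨j, hj⟩ hS
    exact absurd (hS j hj) (by simp [Sep, ALC.sem])
  | top =>
    intro p i X hv ⟨j, hj⟩ hS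
    exact absurd (hS j hj) (by simp [Sep, ALC.sem, an_dom hv, bn_dom hv hj])
  | atom A =>
    intro p i X hv ⟨j, hj⟩ hS
    by_cases hA : A = 0
    · subst hA
      have key : ∀ j ∈ X, p = false ∧ i = n ∧ j = 0 := by
        intro j hj
        have h := hS j hj
        obtain ⟨hi, hp, hm⟩ := hv
        have hm := hm j hj
        by_contra hcon
        apply h
        cases p <;> by_cases h0 : j = 0 <;>
          simp [ALC.sem, Iinterp, an, bn, h0, eA, eAA, eAA', eB, eBB, eBB', eC, el_inj] at hcon ⊢
        · exact hcon
        · have := hm.1; omega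
      obtain ⟨rfl, rfl, -⟩ := key j hj
      exact ⟨∅, by simp, fun j hj h0 => absurd (key j hj).2.2 h0, by simp [ALC.size]⟩
    · exact absurd (hS j hj) (by simp [Sep, ALC.sem, Iinterp, hA])
  | neg D ih =>
    intro p i X hv hX hS
    refine (ih p i X hv hX fun j hj => ?_).mono (by simp [ALC.size])
    have := hS j hj
    simp only [Sep, ALC.sem, Set.mem_diff, an_dom hv, bn_dom hv hj, true_and] at this ⊢
    tauto
  | inter D1 D2 h1 h2 =>
    refine Q_bin h1 h2 le_rfl fun x y h => ?_
    simp only [Sep, ALC.sem, Set.mem_inter_iff] at h ⊢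
    tauto
  | union D1 D2 h1 h2 =>
    refine Q_bin h1 h2 le_rfl fun x y h => ?_
    simp only [Sep, ALC.sem, Set.mem_union] at h ⊢
    tauto
  | all ρ D ih =>
    refine Q_quant ρ ih le_rfl (fun x x' hx hd => det_all hx hd D) fun hρ x y hx hy => ?_
    simp [Sep, ALC.sem, I_no hρ, hx, hy]
  | ex ρ D ih =>
    refine Q_quant ρ ih le_rfl (fun x x' hx hd => det_ex hd D) fun hρ x y hx hy => ?_
    simp [Sep, ALC.sem, I_no hρ]

/-- the common part -/
def core (m n : ℕ) (S : ℕ → Set ℕ) : Set ℕ := Jdom m n S \ {eB}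

theorem core_edge {x e ρ : ℕ} (hx : x ∈ core m n S) :
    ((x, e) ∈ (Iinterp m n S).rI ρ ↔ (x, e) ∈ (Jinterp m n S).rI ρ) ∧
    ((x, e) ∈ (Jinterp m n S).rI ρ → e ∈ core m n S) := by
  by_cases h0 : ρ = 0
  · subst h0
    obtain ⟨((hx | ⟨j, i, h1, h2, h3, rfl⟩) | ⟨j, i, h1, h2, h3, h4, h5, rfl⟩) | rfl, hb⟩ := hx
    · exact absurd hx hb
    all_goals
      simp [Iinterp, Jinterp, core, Jdom, JrPairs, IrPairs, JrCore, eA, eAA, eAA', eB, eBB, eBB', eC, el_inj]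
    all_goals try grind [el_inj]
  by_cases h1 : ρ = 1
  · subst h1
    obtain ⟨((hx | ⟨j, i, h1, h2, h3, rfl⟩) | ⟨j, i, h1, h2, h3, h4, h5, rfl⟩) | rfl, hb⟩ := hx
    · exact absurd hx hb
    all_goals
      simp [Iinterp, Jinterp, core, Jdom, JsPairs, IsPairs, eA, eAA, eAA', eB, eBB, eBB', eC, el_inj]
    all_goals try grind [el_inj]
  · simp [Iinterp, Jinterp, h0, h1]

theorem core_sem (D : ALC) : ∀ x ∈ core m n S,
    (x ∈ D.sem (Iinterp m n S) ↔ x ∈ D.sem (Jinterp m n S)) := by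
  have hI : ∀ x ∈ core m n S, x ∈ (Iinterp m n S).dom := fun x hx => Or.inl (Or.inl (Or.inl hx))
  have hJ : ∀ x ∈ core m n S, x ∈ (Jinterp m n S).dom := fun x hx => hx.1
  induction D with
  | bot => intro x hx; simp [ALC.sem]
  | top => intro x hx; simp [ALC.sem, hI x hx, hJ x hx]
  | atom A =>
    intro x hx
    have : x ≠ eAA n := by
      rintro rfl
      simp [core, Jdom, eAA, eB, eBB, eBB', eC, el_inj] at hx
    by_cases hA : A = 0 <;> simp [ALC.sem, Iinterp, Jinterp, hA, this]
  | neg D ih => intro x hx; simp [ALC.sem, hI x hx, hJ x hx, ih x hx]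
  | inter D1 D2 h1 h2 => intro x hx; simp [ALC.sem, h1 x hx, h2 x hx]
  | union D1 D2 h1 h2 => intro x hx; simp [ALC.sem, h1 x hx, h2 x hx]
  | all ρ D ih =>
    intro x hx
    simp only [ALC.sem, Set.mem_setOf_eq, hI x hx, hJ x hx, true_and]
    refine forall_congr' fun e => ?_
    rw [(core_edge hx).1]
    exact imp_congr_right fun h => ih e ((core_edge hx).2 h)
  | ex ρ D ih =>
    intro x hx
    simp only [ALC.sem, Set.mem_setOf_eq]
    refine exists_congr fun e => ?_
    rw [(core_edge hx).1]
    exact and_congr_right fun h => ih e ((core_edge hx).2 h)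

theorem I_root {e ρ : ℕ} : (eA, e) ∈ (Iinterp m n S).rI ρ ↔
    ρ = 0 ∧ (e = eAA 0 ∨ ∃ j, 1 ≤ j ∧ j ≤ m ∧ e = eBB j 0) := by
  by_cases h0 : ρ = 0
  · simp [h0, Iinterp, IrPairs, JrCore, eA, eAA, eAA', eB, eBB, eBB', eC, el_inj]
  by_cases h1 : ρ = 1
  · simp [h1, Iinterp, IsPairs, JsPairs, eA, eAA, eAA', eB, eBB, eBB', eC, el_inj]
  · simp [Iinterp, h0, h1]

theorem J_root {e ρ : ℕ} : (eB, e) ∈ (Jinterp m n S).rI ρ ↔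
    ρ = 0 ∧ (∃ j, 1 ≤ j ∧ j ≤ m ∧ e = eBB j 0) := by
  by_cases h0 : ρ = 0
  · simp [h0, Jinterp, JrPairs, JrCore, eA, eAA, eAA', eB, eBB, eBB', eC, el_inj]
  by_cases h1 : ρ = 1
  · simp [h1, Jinterp, JsPairs, eA, eAA, eAA', eB, eBB, eBB', eC, el_inj]
  · simp [Jinterp, h0, h1]

theorem b0_core {j : ℕ} (h1 : 1 ≤ j) (h2 : j ≤ m) : eBB j 0 ∈ core m n S :=
  ⟨Or.inl (Or.inl (Or.inr ⟨j, 0, h1, h2, Nat.zero_le _, rfl⟩)), by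
    simp [eB, eBB, el_inj]⟩

theorem a_dom : eA ∈ (Iinterp m n S).dom := Or.inl (Or.inl (Or.inr rfl))
theorem b_dom : eB ∈ (Jinterp m n S).dom := Or.inl (Or.inl (Or.inl rfl))

theorem root_sep (C : ALC)
    (h : ¬ (eA ∈ C.sem (Iinterp m n S) ↔ eB ∈ C.sem (Jinterp m n S))) :
    ∃ D : ALC, D.size + 1 ≤ C.size ∧
      ∀ j, 1 ≤ j → j ≤ m → Sep m n S D (eAA 0) (eBB j 0) := by
  induction C with
  | bot => simp [ALC.sem] at h
  | top => exact absurd h (by simp [ALC.sem, a_dom, b_dom])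
  | atom A =>
    exfalso; apply h
    by_cases hA : A = 0 <;>
      simp [ALC.sem, Iinterp, Jinterp, hA, eA, eAA, eB, eBB, el_inj]
  | neg D ih =>
    obtain ⟨E, h1, h2⟩ := ih (by
      simp only [ALC.sem, Set.mem_diff, a_dom, b_dom, true_and] at h
      tauto)
    exact ⟨E, by simp only [ALC.size]; omega, h2⟩
  | inter D1 D2 h1 h2 =>
    have : ¬ (eA ∈ D1.sem (Iinterp m n S) ↔ eB ∈ D1.sem (Jinterp m n S)) ∨
        ¬ (eA ∈ D2.sem (Iinterp m n S) ↔ eB ∈ D2.sem (Jinterp m n S)) := by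
      simp only [ALC.sem, Set.mem_inter_iff] at h
      tauto
    rcases this with h | h
    · obtain ⟨E, a, b⟩ := h1 h
      exact ⟨E, by simp only [ALC.size]; omega, b⟩
    · obtain ⟨E, a, b⟩ := h2 h
      exact ⟨E, by simp only [ALC.size]; omega, b⟩
  | union D1 D2 h1 h2 =>
    have : ¬ (eA ∈ D1.sem (Iinterp m n S) ↔ eB ∈ D1.sem (Jinterp m n S)) ∨
        ¬ (eA ∈ D2.sem (Iinterp m n S) ↔ eB ∈ D2.sem (Jinterp m n S)) := by
      simp only [ALC.sem, Set.mem_union] at h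
      tauto
    rcases this with h | h
    · obtain ⟨E, a, b⟩ := h1 h
      exact ⟨E, by simp only [ALC.size]; omega, b⟩
    · obtain ⟨E, a, b⟩ := h2 h
      exact ⟨E, by simp only [ALC.size]; omega, b⟩
  | all ρ D ih =>
    refine ⟨D, le_rfl, fun j h1 h2 hiff => h ?_⟩
    simp only [ALC.sem, Set.mem_setOf_eq, a_dom, b_dom, true_and, I_root, J_root]
    constructor
    · rintro hh e ⟨h0, j', a, b, rfl⟩
      exact (core_sem D _ (b0_core a b)).1 (hh _ ⟨h0, Or.inr ⟨j', a, b, rfl⟩⟩)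
    · rintro hh e ⟨h0, rfl | ⟨j', a, b, rfl⟩⟩
      · exact hiff.2 ((core_sem D _ (b0_core h1 h2)).2 (hh _ ⟨h0, j, h1, h2, rfl⟩))
      · exact (core_sem D _ (b0_core a b)).2 (hh _ ⟨h0, j', a, b, rfl⟩)
  | ex ρ D ih =>
    refine ⟨D, le_rfl, fun j h1 h2 hiff => h ?_⟩
    simp only [ALC.sem, Set.mem_setOf_eq, I_root, J_root]
    constructor
    · rintro ⟨e, ⟨h0, rfl | ⟨j', a, b, rfl⟩⟩, he⟩
      · exact ⟨_, ⟨h0, j, h1, h2, rfl⟩, (core_sem D _ (b0_core h1 h2)).1 (hiff.1 he)⟩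
      · exact ⟨_, ⟨h0, j', a, b, rfl⟩, (core_sem D _ (b0_core a b)).1 he⟩
    · rintro ⟨e, ⟨h0, j', a, b, rfl⟩, he⟩
      exact ⟨_, ⟨h0, Or.inr ⟨j', a, b, rfl⟩⟩, (core_sem D _ (b0_core a b)).2 he⟩

theorem hs_lang (H : Finset ℕ) (i : ℕ) : (hsConcept H n i).InLang {Op.ex} := by
  induction i with
  | zero => simp [hsConcept, ALC.InLang]
  | succ i ih => unfold hsConcept; split_ifs <;> simp [ALC.InLang, ih]

theorem hs_size (H : Finset ℕ) (i : ℕ) (hi : i ≤ n) :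
    (hsConcept H n i).size ≤ i + (H ∩ Finset.Ioc (n - i) n).card + 1 := by
  induction i with
  | zero => simp [hsConcept, ALC.size]
  | succ i ih =>
    have ih := ih (by omega)
    unfold hsConcept
    have hsub : H ∩ Finset.Ioc (n - i) n ⊆ H ∩ Finset.Ioc (n - (i+1)) n :=
      Finset.inter_subset_inter_left (Finset.Ioc_subset_Ioc_left (by omega))
    split_ifs with h
    · have : (H ∩ Finset.Ioc (n - i) n).card < (H ∩ Finset.Ioc (n - (i+1)) n).card := by
        apply Finset.card_lt_card
        refine ⟨hsub, fun hh => ?_⟩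
        have : n - i ∈ H ∩ Finset.Ioc (n - i) n := hh (by simp [h]; omega)
        simp at this
      simp only [ALC.size]; omega
    · have := Finset.card_le_card hsub
      simp only [ALC.size]; omega

theorem hs_a (H : Finset ℕ) (i : ℕ) (hi : i ≤ n) :
    eAA (n - i) ∈ (hsConcept H n i).sem (Iinterp m n S) := by
  induction i with
  | zero => simp [hsConcept, ALC.sem, Iinterp]
  | succ i ih =>
    have ih := ih (by omega)
    have e : n - (i + 1) + 1 = n - i := by omega
    unfold hsConcept
    split_ifs with h
    · rw [det_ex (I_a1 (by omega)), e, det_ex (I_a'1 (by omega) (by omega))]; exact ih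
    · rw [det_ex (I_a0 (by omega)), e]; exact ih

theorem c_hs (H : Finset ℕ) (i : ℕ) : eC ∉ (hsConcept H n i).sem (Iinterp m n S) := by
  induction i with
  | zero => simp [hsConcept, ALC.sem, Iinterp, eC, eBB, eAA, el_inj]
  | succ i ih =>
    unfold hsConcept
    split_ifs with h
    · rw [det_ex (I_c 1 (by omega)), det_ex (I_c 1 (by omega))]; exact ih
    · rw [det_ex (I_c 0 (by omega))]; exact ih

theorem hs_b (H : Finset ℕ) (i : ℕ) (hi : i ≤ n) {j : ℕ} (h1 : 1 ≤ j) (h2 : j ≤ m)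
    (hb : eBB j (n - i) ∈ (hsConcept H n i).sem (Iinterp m n S)) :
    ∀ x ∈ H, n - i < x → x ≤ n → x ∉ S j := by
  induction i with
  | zero => intro x _ _ _; omega
  | succ i ih =>
    have e : n - (i + 1) + 1 = n - i := by omega
    intro x hx hlt hle
    unfold hsConcept at hb
    split_ifs at hb with h
    · by_cases hs : n - i ∈ S j
      · rw [det_ex (I_b1c h1 h2 (by omega) (by rwa [e])), det_ex (I_c 1 (by omega))] at hb
        exact absurd hb (c_hs H i)
      · rw [det_ex (I_b1 h1 h2 (by omega) (by rwa [e])), e,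
          det_ex (I_b'1 h1 h2 (by omega) (by omega) hs)] at hb
        by_cases hxe : x = n - i
        · rwa [hxe]
        · exact ih (by omega) hb x hx (by omega) hle
    · rw [det_ex (I_b0 h1 h2 (by omega)), e] at hb
      have hxe : x ≠ n - i := by rintro rfl; exact h hx
      exact ih (by omega) hb x hx (by omega) hle

end

/-- If there is an ALC concept of size at most k' = n + k + 2 that fits
P = {(I,a)}, N = {(J,b)}, then there is an L({∃}) concept of size at most k' of the
form ∃r.D that fits P, N. -/
theorem statement7 (m n k : ℕ) (S : ℕ → Set ℕ)
    (hS : ∀ j, 1 ≤ j → j ≤ m → S j ⊆ Set.Icc 1 n)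
    (hcov : ⋃ j ∈ Set.Icc 1 m, S j = Set.Icc 1 n)
    (h : ∃ C : ALC, C.size ≤ n + k + 2 ∧
      Fits C {(Iinterp m n S, eA)} {(Jinterp m n S, eB)}) :
    ∃ D : ALC, (ALC.ex 0 D).InLang {Op.ex} ∧ (ALC.ex 0 D).size ≤ n + k + 2 ∧
      Fits (ALC.ex 0 D) {(Iinterp m n S, eA)} {(Jinterp m n S, eB)} := by
  obtain ⟨C, hsz, hP, hN⟩ := h
  have hP := hP _ rfl
  have hN := hN _ rfl
  obtain ⟨D, hD, hsep⟩ := root_sep C (fun hh => hN (hh.1 hP))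
  by_cases hm : m = 0
  · refine ⟨.top, by simp [ALC.InLang], by simp [ALC.size], ?_, ?_⟩
    · rintro _ rfl
      refine ⟨eAA 0, I_root.2 ⟨rfl, Or.inl rfl⟩, ?_⟩
      exact Or.inl (Or.inr ⟨0, Nat.zero_le _, rfl⟩)
    · rintro _ rfl ⟨e, he, -⟩
      obtain ⟨-, j, h1, h2, -⟩ := J_root.1 he
      omega
  obtain ⟨H, a, b, c⟩ := Q_all (m := m) (n := n) (S := S) D false 0 (Set.Icc 1 m)
    ⟨Nat.zero_le _, by simp, fun j hj => ⟨hj.2, by simp⟩⟩ ⟨1, le_rfl, by omega⟩ (by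
      intro j hj
      have h0 : j ≠ 0 := by have := hj.1; omega
      simpa [an, bn, h0] using hsep j hj.1 hj.2)
  refine ⟨hsConcept H n n, ?_, ?_, ?_, ?_⟩
  · exact ⟨rfl, hs_lang H n⟩
  · have h1 := hs_size (n := n) H n le_rfl
    have h2 := Finset.card_le_card (Finset.inter_subset_left (s₁ := H) (s₂ := Finset.Ioc (n - n) n))
    simp only [ALC.size]
    simp only [Nat.sub_zero, Bool.false_eq_true, if_false] at c
    omega
  · rintro _ rfl
    refine ⟨eAA 0, I_root.2 ⟨rfl, Or.inl rfl⟩, ?_⟩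
    have := hs_a (m := m) (n := n) (S := S) H n le_rfl
    rwa [Nat.sub_self] at this
  · rintro _ rfl ⟨e, he, he'⟩
    obtain ⟨-, j, h1, h2, rfl⟩ := J_root.1 he
    have he' := (core_sem _ _ (b0_core h1 h2)).2 he'
    obtain ⟨x, hx, hxS⟩ := b j ⟨h1, h2⟩ (by omega)
    have hx' := Finset.mem_Ioc.1 (a hx)
    exact hs_b (m := m) (n := n) (S := S) H n le_rfl h1 h2 (by rwa [Nat.sub_self]) x hx
      (by omega) hx'.2 hxS

end ALCPaper
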